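/- arXiv:2505.16015 — 2 statements merged into one kernel-verified Lean document; each statement's English description precedes it below -/
import Mathlib

section
/- Let d, n ∈ ℕ with d ≥ 2 and n ≥ d + 2. Then the algebraic connectivity of the generalized path graph is at most that of the generalized cycle graph on twice as many vertices: a₁(P_{n,d}) ≤ a₁(C_{2n,d}). -/
/-- The generalized path graph `P_{n,d}` on vertex set `Fin n` (vertex `i` stands for the
label `i + 1 ∈ {1, …, n}`): two vertices are adjacent iff their labels differ by at most
`d` (and at least `1`). -/
def genPath (n d : ℕ) : SimpleGraph (Fin n) :=
  SimpleGraph.fromRel (fun i j => (i : ℕ) < (j : ℕ) ∧ (j : ℕ) - (i : ℕ) ≤ d)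
/-- The generalized cycle graph `C_{n,d}` on vertex set `Fin n`: distinct vertices `i, j`
are adjacent iff `(j - i) mod n ∈ {1, …, d}` or `(i - j) mod n ∈ {1, …, d}`. -/
def genCycle (n d : ℕ) : SimpleGraph (Fin n) :=
  SimpleGraph.fromRel (fun i j => ∃ k : ℕ, 1 ≤ k ∧ k ≤ d ∧ ((i : ℕ) + k) % n = (j : ℕ))
open Classical in
/-- The Laplacian quadratic form `⟨L(G) x, x⟩`. -/
noncomputable def lapQuad {m : ℕ} (G : SimpleGraph (Fin m)) (x : Fin m → ℝ) : ℝ :=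
  ∑ i, (SimpleGraph.lapMatrix ℝ G).mulVec x i * x i

/-- The algebraic connectivity `a₁(G)`: the minimum of the Rayleigh quotient
`⟨L(G)x, x⟩ / ⟨x, x⟩` over nonzero `x` with `∑ i, x i = 0` (for a connected graph on
at least two vertices this is the second-smallest Laplacian eigenvalue). -/
noncomputable def algConn {m : ℕ} (G : SimpleGraph (Fin m)) : ℝ :=
  sInf {r : ℝ | ∃ x : Fin m → ℝ, x ≠ 0 ∧ (∑ i, x i) = 0 ∧
    r = lapQuad G x / (∑ i, x i * x i)}

lemma lapQuad_eq {m : ℕ} (G : SimpleGraph (Fin m)) [DecidableRel G.Adj] (x : Fin m → ℝ) :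
    lapQuad G x = (∑ i, ∑ j, if G.Adj i j then (x i - x j) ^ 2 else 0) / 2 := by
  classical
  have h := SimpleGraph.lapMatrix_toLinearMap₂' (R := ℝ) G x
  rw [Matrix.toLinearMap₂'_apply'] at h
  rw [← h, lapQuad, dotProduct]
  refine Finset.sum_congr rfl fun i _ => ?_
  rw [mul_comm]
  congr!

lemma lapQuad_nonneg {m : ℕ} (G : SimpleGraph (Fin m)) (x : Fin m → ℝ) : 0 ≤ lapQuad G x := by
  classical
  rw [lapQuad_eq]
  refine div_nonneg (Finset.sum_nonneg fun i _ => Finset.sum_nonneg fun j _ => ?_) (by norm_num)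
  split_ifs <;> positivity

/-- The variational inequality defining the algebraic connectivity. -/
lemma algConn_mul_le {m : ℕ} (G : SimpleGraph (Fin m)) (x : Fin m → ℝ) (hx : ∑ i, x i = 0) :
    algConn G * ∑ i, x i ^ 2 ≤ lapQuad G x := by
  by_cases h0 : x = 0
  · subst h0
    simpa using lapQuad_nonneg G 0
  have hpos : 0 < ∑ i, x i ^ 2 := by
    obtain ⟨i, hi⟩ := Function.ne_iff.mp h0
    exact Finset.sum_pos' (fun _ _ => sq_nonneg _) ⟨i, Finset.mem_univ _, by
      have : x i ≠ 0 := hi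
      positivity⟩
  rw [← le_div_iff₀ hpos]
  refine csInf_le ⟨0, ?_⟩ ⟨x, h0, hx, by simp only [sq]⟩
  rintro r ⟨y, -, -, rfl⟩
  exact div_nonneg (lapQuad_nonneg G y) (Finset.sum_nonneg fun i _ => mul_self_nonneg _)

/-- The energy of `x` on the Cayley graph of `A` with edge weights `w`. -/
def shiftEnergy {A : Type*} [AddCommGroup A] [Fintype A] (w x : A → ℝ) : ℝ :=
  ∑ t, w t * ∑ i, (x (i + t) - x i) ^ 2

section Group

variable {A : Type*} [AddCommGroup A] [Fintype A]

lemma sum_add_right_eq (f : A → ℝ) (t : A) : ∑ i, f (i + t) = ∑ i, f i :=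
  Equiv.sum_comp (Equiv.addRight t) f

lemma sum_sub_left_eq (f : A → ℝ) (t : A) : ∑ i, f (t - i) = ∑ i, f i :=
  Equiv.sum_comp (Equiv.subLeft t) f

lemma sum_eq_zero_of_sum_double_eq_zero {u : A → ℝ} (hu : ∀ c, ∑ i, u (c + (i + i)) = 0) :
    ∑ a, u a = 0 := by
  have h : ∑ i : A, ∑ c, u (c + (i + i)) = 0 := by
    rw [Finset.sum_comm]
    exact Finset.sum_eq_zero fun c _ => hu c
  simp only [sum_add_right_eq u, Finset.sum_const, Finset.card_univ, nsmul_eq_mul] at h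
  exact (mul_eq_zero.mp h).resolve_left (by exact_mod_cast Fintype.card_ne_zero)

lemma sum_mul_eq_zero_of_double_periodic {u v : A → ℝ} (hu : ∀ c, ∑ i, u (c + (i + i)) = 0)
    (hv : ∀ c i, v (c + (i + i)) = v c) : ∑ a, u a * v a = 0 := by
  refine sum_eq_zero_of_sum_double_eq_zero (u := fun a => u a * v a) fun c => ?_
  simp only [hv, ← Finset.sum_mul, hu, zero_mul]

lemma sum_double_diff_eq_zero {u : A → ℝ} (hu : ∀ c, ∑ i, u (c + (i + i)) = 0) (t c : A) :
    ∑ i, (u (c + (i + i) + t) - u (c + (i + i))) = 0 := by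
  simp only [Finset.sum_sub_distrib, hu, add_right_comm _ _ t, sub_zero]

lemma sum_reflected_mul_eq_zero {u : A → ℝ} (hu : ∀ c, ∑ i, u (c + (i + i)) = 0) (e : A) :
    ∑ s, ∑ i, u (s + i) * u (s - e - i) = 0 := by
  rw [Finset.sum_comm]
  have h : ∀ i, ∑ s, u (s + i) * u (s - e - i) = ∑ s, u s * u (s - e + (-i + -i)) := fun i => by
    rw [← sum_add_right_eq (fun s => u s * u (s - e + (-i + -i))) i]
    refine Finset.sum_congr rfl fun s _ => ?_
    congr 2
    abel
  simp only [h]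
  rw [Finset.sum_comm]
  refine Finset.sum_eq_zero fun s _ => ?_
  have h' : ∑ i, u (s - e + (-i + -i)) = ∑ i, u (s - e + (i + i)) :=
    Equiv.sum_comp (Equiv.neg A) fun i => u (s - e + (i + i))
  rw [← Finset.mul_sum, h', hu, mul_zero]

lemma sum_reflected_sq {u : A → ℝ} (hu : ∀ c, ∑ i, u (c + (i + i)) = 0) (e : A) (r : ℝ)
    (hr : r ^ 2 = 1) :
    ∑ s, ∑ i, (u (s + i) + r * u (s - e - i)) ^ 2 = 2 * Fintype.card A * ∑ i, u i ^ 2 := by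
  have h : ∀ s, ∑ i, (u (s + i) + r * u (s - e - i)) ^ 2 =
      2 * ∑ i, u i ^ 2 + 2 * r * ∑ i, u (s + i) * u (s - e - i) := fun s => by
    have h1 : ∑ i, u (s + i) ^ 2 = ∑ i, u i ^ 2 :=
      Equiv.sum_comp (Equiv.addLeft s) fun i => u i ^ 2
    have h2 : ∑ i, u (s - e - i) ^ 2 = ∑ i, u i ^ 2 := sum_sub_left_eq (fun i => u i ^ 2) (s - e)
    calc _ = ∑ i, (u (s + i) ^ 2 + u (s - e - i) ^ 2 + 2 * r * (u (s + i) * u (s - e - i))) :=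
          Finset.sum_congr rfl fun i _ => by linear_combination u (s - e - i) ^ 2 * hr
      _ = _ := by
          rw [Finset.sum_add_distrib, Finset.sum_add_distrib, h1, h2, ← Finset.mul_sum]
          ring
  simp only [h, Finset.sum_add_distrib, ← Finset.mul_sum, sum_reflected_mul_eq_zero hu e,
    Finset.sum_const, Finset.card_univ, nsmul_eq_mul]
  ring

/-- A spectral-gap inequality for reflection-symmetric functions extends to all functions with
vanishing sums over the cosets of `2 • A`, by averaging over all reflections. -/
lemma gap_of_symmetric_gap {w : A → ℝ} {a : ℝ} {e : A}
    (h : ∀ y : A → ℝ, (∀ i, y (-e - i) = y i) → ∑ i, y i = 0 →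
      a * ∑ i, y i ^ 2 ≤ shiftEnergy w y)
    {z : A → ℝ} (hz : ∀ c, ∑ i, z (c + (i + i)) = 0) :
    a * ∑ i, z i ^ 2 ≤ shiftEnergy w z := by
  have hsum := sum_eq_zero_of_sum_double_eq_zero hz
  have key : ∑ s : A, a * ∑ i, (z (s + i) + 1 * z (s - e - i)) ^ 2 ≤
      ∑ s : A, shiftEnergy w fun i => z (s + i) + 1 * z (s - e - i) := by
    refine Finset.sum_le_sum fun s _ => h _ (fun i => ?_) ?_
    · rw [one_mul, one_mul, add_comm]
      congr 2 <;> abel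
    · have h' : ∑ i, z (s + i) = ∑ i, z i := Equiv.sum_comp (Equiv.addLeft s) z
      simp only [one_mul, Finset.sum_add_distrib, sum_sub_left_eq z, h', hsum, add_zero]
  have henergy : ∑ s : A, shiftEnergy w (fun i => z (s + i) + 1 * z (s - e - i)) =
      2 * Fintype.card A * shiftEnergy w z := by
    unfold shiftEnergy
    rw [Finset.sum_comm, Finset.mul_sum]
    refine Finset.sum_congr rfl fun t _ => ?_
    rw [← Finset.mul_sum, mul_left_comm,
      ← sum_reflected_sq (u := fun i => z (i + t) - z i) (sum_double_diff_eq_zero hz t) (e + t) (-1)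
        (by norm_num)]
    congr 1
    refine Finset.sum_congr rfl fun s _ => Finset.sum_congr rfl fun i _ => ?_
    have h1 : s + (i + t) = s + i + t := by abel
    have h2 : s - e - (i + t) = s - (e + t) - i := by abel
    have h3 : s - e - i = s - (e + t) - i + t := by abel
    simp only [h1, h2, h3]
    ring
  rw [henergy, ← Finset.mul_sum, sum_reflected_sq hz e 1 (by norm_num)] at key
  have hc : (0 : ℝ) < 2 * Fintype.card A := by
    have : (0 : ℝ) < Fintype.card A := by exact_mod_cast Fintype.card_pos
    positivity
  refine le_of_mul_le_mul_left ?_ hc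
  linarith

lemma shiftEnergy_add_of_double_periodic {w z g : A → ℝ} (hz : ∀ c, ∑ i, z (c + (i + i)) = 0)
    (hg : ∀ c i, g (c + (i + i)) = g c) :
    shiftEnergy w (z + g) = shiftEnergy w z + shiftEnergy w g := by
  unfold shiftEnergy
  rw [← Finset.sum_add_distrib]
  refine Finset.sum_congr rfl fun t _ => ?_
  have h := sum_mul_eq_zero_of_double_periodic (u := fun i => z (i + t) - z i)
    (v := fun i => g (i + t) - g i) (sum_double_diff_eq_zero hz t)
    (fun c i => by simp only [hg, add_right_comm _ _ t])
  rw [← mul_add]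
  congr 1
  calc _ = ∑ i, ((z (i + t) - z i) ^ 2 + (g (i + t) - g i) ^ 2 +
        2 * ((z (i + t) - z i) * (g (i + t) - g i))) :=
        Finset.sum_congr rfl fun i _ => by simp only [Pi.add_apply]; ring
    _ = _ := by
        rw [Finset.sum_add_distrib, Finset.sum_add_distrib, ← Finset.mul_sum, h, mul_zero, add_zero]

lemma sum_sq_add_of_double_periodic {z g : A → ℝ} (hz : ∀ c, ∑ i, z (c + (i + i)) = 0)
    (hg : ∀ c i, g (c + (i + i)) = g c) :
    ∑ i, (z + g) i ^ 2 = ∑ i, z i ^ 2 + ∑ i, g i ^ 2 := by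
  calc _ = ∑ i, (z i ^ 2 + g i ^ 2 + 2 * (z i * g i)) :=
        Finset.sum_congr rfl fun i _ => by simp only [Pi.add_apply]; ring
    _ = _ := by
        rw [Finset.sum_add_distrib, Finset.sum_add_distrib, ← Finset.mul_sum,
          sum_mul_eq_zero_of_double_periodic hz hg, mul_zero, add_zero]

/-- In a cyclic group, a function of mean zero splits into a part with vanishing sums over the
cosets of `2 • A` and an alternating part. -/
lemma exists_double_decomposition {e : A} (he : ∀ t : A, ∃ k : ℕ, t = k • e) {x : A → ℝ}
    (hx : ∑ i, x i = 0) :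
    ∃ z g : A → ℝ, x = z + g ∧ (∀ c, ∑ i, z (c + (i + i)) = 0) ∧
      (∀ c i, g (c + (i + i)) = g c) ∧ ∀ c, g (c + e) = -g c := by
  have hN : (Fintype.card A : ℝ) ≠ 0 := by exact_mod_cast Fintype.card_ne_zero
  set g : A → ℝ := fun c => (∑ i, x (c + (i + i))) / Fintype.card A with hgdef
  have hg : ∀ c i, g (c + (i + i)) = g c := fun c i => by
    simp only [hgdef]
    congr 1
    rw [← sum_add_right_eq (fun j => x (c + (j + j))) i]
    refine Finset.sum_congr rfl fun j _ => ?_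
    congr 1
    abel
  refine ⟨x - g, g, by simp, fun c => ?_, hg, fun c => ?_⟩
  · simp only [Pi.sub_apply, Finset.sum_sub_distrib, hg, Finset.sum_const, Finset.card_univ,
      nsmul_eq_mul]
    simp only [hgdef]
    field_simp
    ring
  · have hstep : ∀ c, g (c + e) + g (c + e + e) = g c + g (c + e) := fun c => by
      rw [add_assoc c e e, hg, add_comm]
    have hmul : ∀ k : ℕ, g (k • e) + g (k • e + e) = g 0 + g (0 + e) := fun k => by
      induction k with
      | zero => simp
      | succ k ih => rw [succ_nsmul, hstep, ih]
    have hconst : ∀ c, g c + g (c + e) = g 0 + g (0 + e) := fun c => by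
      obtain ⟨k, rfl⟩ := he c
      exact hmul k
    have hgsum : ∑ c, g c = 0 := by
      simp only [hgdef, ← Finset.sum_div]
      rw [Finset.sum_comm]
      simp only [sum_add_right_eq x, hx, Finset.sum_const_zero, zero_div]
    have htot : ∑ c, (g c + g (c + e)) = 0 := by
      rw [Finset.sum_add_distrib, sum_add_right_eq g, hgsum, add_zero]
    simp only [hconst, Finset.sum_const, Finset.card_univ, nsmul_eq_mul] at htot
    have := (mul_eq_zero.mp htot).resolve_left hN
    linarith [hconst c]

end Group

lemma alternating_add_nsmul {A : Type*} [AddCommGroup A] {e : A} {g : A → ℝ} (hg : ∀ c, g (c + e) = -g c) (k : ℕ) (c : A) :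
    g (c + k • e) = (-1) ^ k * g c := by
  induction k with
  | zero => simp
  | succ k ih => rw [succ_nsmul, ← add_assoc, hg, ih]; ring

/-- The Rayleigh bound for the indicator of a vertex with its mean removed. -/
lemma algConn_mul_le_degree {m : ℕ} (G : SimpleGraph (Fin m)) [DecidableRel G.Adj] (v : Fin m) :
    algConn G * (1 - 1 / m) ≤ ∑ j, if G.Adj v j then (1 : ℝ) else 0 := by
  have hm : (m : ℝ) ≠ 0 := by exact_mod_cast (Fin.pos v).ne'
  have h := algConn_mul_le G (fun i => (if i = v then (1 : ℝ) else 0) - 1 / m) (by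
    simp [Finset.sum_sub_distrib, hm])
  have hsq : ∑ i, ((if i = v then (1 : ℝ) else 0) - 1 / (m : ℝ)) ^ 2 = (1 - 1 / m : ℝ) := by
    calc _ = ∑ i, ((1 - 2 / m) * (if i = v then (1 : ℝ) else 0) + (1 / m) ^ 2) :=
          Finset.sum_congr rfl fun i _ => by split_ifs <;> ring
      _ = _ := by
          rw [Finset.sum_add_distrib, ← Finset.mul_sum]
          simp only [Finset.sum_ite_eq', Finset.mem_univ, if_true, Finset.sum_const,
            Finset.card_univ, Fintype.card_fin, nsmul_eq_mul]
          field_simp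
          ring
  have hQ : lapQuad G (fun i => (if i = v then (1 : ℝ) else 0) - 1 / m) =
      ∑ j, if G.Adj v j then (1 : ℝ) else 0 := by
    rw [lapQuad_eq]
    have h1 : ∀ i j, (if G.Adj i j then (((if i = v then (1 : ℝ) else 0) - 1 / m) -
        ((if j = v then (1 : ℝ) else 0) - 1 / m)) ^ 2 else 0) =
        (if i = v then (if G.Adj v j then 1 else 0) else 0) +
        (if j = v then (if G.Adj v i then 1 else 0) else 0) := fun i j => by
      by_cases hi : i = v
      · subst hi
        by_cases hj : j = i
        · subst hj
          simp
        · simp [hj]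
      · by_cases hj : j = v
        · subst hj
          have hsq1 : ((0 : ℝ) - 1 / m - (1 - 1 / m)) ^ 2 = 1 := by ring
          simp only [if_neg hi, if_true, G.adj_comm i j, hsq1, zero_add]
        · simp [hi, hj]
    simp only [h1, Finset.sum_add_distrib]
    rw [Finset.sum_comm]
    simp
  rwa [hsq, hQ] at h

lemma genPath_adj {n d : ℕ} {i j : Fin n} :
    (genPath n d).Adj i j ↔ i ≠ j ∧ (i : ℕ) ≤ j + d ∧ (j : ℕ) ≤ i + d := by
  rw [genPath, SimpleGraph.fromRel_adj, ne_eq, Fin.ext_iff]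
  omega

lemma algConn_genPath_le {n d : ℕ} (hn : 2 ≤ n) : algConn (genPath n d) ≤ 2 * d := by
  classical
  have h := algConn_mul_le_degree (genPath n d) ⟨0, by omega⟩
  have hdeg : (∑ j, if (genPath n d).Adj ⟨0, by omega⟩ j then (1 : ℝ) else 0) ≤ d := by
    rw [Finset.sum_boole]
    have hc : (Finset.univ.filter fun j => (genPath n d).Adj ⟨0, by omega⟩ j).card ≤
        (Finset.Icc 1 d).card := by
      refine Finset.card_le_card_of_injOn (fun j => (j : ℕ)) (fun j hj => ?_)
        (fun i _ j _ hij => Fin.ext hij)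
      simp only [Finset.coe_filter, Finset.mem_univ, true_and, Set.mem_ofPred_eq, genPath_adj,
        ne_eq, Fin.ext_iff] at hj
      simp only [Finset.coe_Icc, Set.mem_Icc]
      omega
    rw [Nat.card_Icc] at hc
    exact_mod_cast hc
  have hn' : (2 : ℝ) ≤ n := by exact_mod_cast hn
  have hinv : (1 : ℝ) / n ≤ 1 / 2 := one_div_le_one_div_of_le (by norm_num) hn'
  by_contra! hlt
  have hd : (0 : ℝ) ≤ d := Nat.cast_nonneg d
  nlinarith

lemma sum_fin_two_mul {n : ℕ} (f : Fin (2 * n) → ℝ) :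
    ∑ i, f i = ∑ j : Fin n, f ⟨j, by omega⟩ + ∑ j : Fin n, f ⟨n + j, by omega⟩ := by
  rw [← Equiv.sum_comp (finCongr (two_mul n).symm) f, Fin.sum_univ_add]
  rfl

lemma genCycle_adj_of_le {N d : ℕ} {i j : Fin N} (hne : i ≠ j) (h1 : (i : ℕ) ≤ j + d)
    (h2 : (j : ℕ) ≤ i + d) : (genCycle N d).Adj i j := by
  rw [genCycle, SimpleGraph.fromRel_adj]
  refine ⟨hne, ?_⟩
  rcases lt_or_gt_of_ne (fun h => hne (Fin.ext h) : (i : ℕ) ≠ j) with h | h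
  · exact Or.inl ⟨j - i, by omega, by omega, by rw [Nat.add_sub_cancel' h.le, Nat.mod_eq_of_lt j.2]⟩
  · exact Or.inr ⟨i - j, by omega, by omega, by rw [Nat.add_sub_cancel' h.le, Nat.mod_eq_of_lt i.2]⟩

lemma lapQuad_halves_le {n d : ℕ} (y : Fin (2 * n) → ℝ) :
    lapQuad (genPath n d) (fun j => y ⟨j, by omega⟩) +
      lapQuad (genPath n d) (fun j => y ⟨n + j, by omega⟩) ≤ lapQuad (genCycle (2 * n) d) y := by
  classical
  rw [lapQuad_eq, lapQuad_eq, lapQuad_eq, ← add_div]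
  refine div_le_div_of_nonneg_right ?_ (by norm_num)
  have hnn : ∀ i j, 0 ≤ if (genCycle (2 * n) d).Adj i j then (y i - y j) ^ 2 else 0 :=
    fun i j => by split_ifs <;> positivity
  rw [sum_fin_two_mul]
  refine add_le_add ?_ ?_ <;> refine Finset.sum_le_sum fun i _ => ?_ <;> rw [sum_fin_two_mul]
  · refine (Finset.sum_le_sum fun j _ => ?_).trans
      (le_add_of_nonneg_right (Finset.sum_nonneg fun j _ => hnn _ _))
    by_cases h : (genPath n d).Adj i j
    · obtain ⟨h0, h1, h2⟩ := genPath_adj.mp h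
      rw [if_pos h, if_pos]
      exact genCycle_adj_of_le (fun h => h0 (by simpa [Fin.ext_iff] using h)) h1 h2
    · rw [if_neg h]
      exact hnn _ _
  · refine (Finset.sum_le_sum fun j _ => ?_).trans
      (le_add_of_nonneg_left (Finset.sum_nonneg fun j _ => hnn _ _))
    by_cases h : (genPath n d).Adj i j
    · obtain ⟨h0, h1, h2⟩ := genPath_adj.mp h
      rw [if_pos h, if_pos]
      refine genCycle_adj_of_le (fun h => h0 (Fin.ext ?_)) ?_ ?_
      · simpa using h
      · simp only
        omega
      · simp only
        omega
    · rw [if_neg h]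
      exact hnn _ _

lemma fin_eq_nsmul_one {N : ℕ} [NeZero N] (t : Fin N) : t = (t : ℕ) • (1 : Fin N) := by
  have h : ∀ k : ℕ, ((k • (1 : Fin N) : Fin N) : ℕ) = k % N := fun k => by
    induction k with
    | zero => simp
    | succ k ih => rw [succ_nsmul, Fin.val_add, ih, Fin.val_one', ← Nat.add_mod]
  exact Fin.ext (by rw [h, Nat.mod_eq_of_lt t.2])

/-- Folding: on reflection-symmetric functions the gap of the path bounds the energy on the
cycle. -/
lemma algConn_genPath_mul_le_of_symmetric {n d : ℕ} [NeZero (2 * n)] {y : Fin (2 * n) → ℝ}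
    (hy : ∀ i, y (-1 - i) = y i) (hsum : ∑ i, y i = 0) :
    algConn (genPath n d) * ∑ i, y i ^ 2 ≤ lapQuad (genCycle (2 * n) d) y := by
  have hrefl : ∀ j : Fin n, y ⟨n + j, by omega⟩ = y ⟨j.rev, by omega⟩ := fun j => by
    rw [← hy]
    congr 1
    rw [sub_eq_iff_eq_add, neg_eq_iff_add_eq_zero, Fin.ext_iff, Fin.val_add, Fin.val_add,
      Fin.val_one', Fin.val_rev]
    simp only [Fin.val_zero]
    rw [← Nat.add_mod]
    rw [show 1 + (n - (↑j + 1) + (n + ↑j)) = 2 * n by omega, Nat.mod_self]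
  have hhalf : ∑ j : Fin n, y ⟨n + j, by omega⟩ = ∑ j : Fin n, y ⟨j, by omega⟩ := by
    simp only [hrefl]
    exact Equiv.sum_comp Fin.revPerm fun j : Fin n => y ⟨j, by omega⟩
  rw [sum_fin_two_mul, hhalf] at hsum
  have h1 := algConn_mul_le (genPath n d) (fun j => y ⟨j, by omega⟩) (by linarith)
  have h2 := algConn_mul_le (genPath n d) (fun j => y ⟨n + j, by omega⟩) (by linarith)
  have h3 := lapQuad_halves_le (d := d) y
  rw [sum_fin_two_mul, mul_add]
  linarith

lemma genCycle_adj_add {N d : ℕ} [NeZero N] (i t : Fin N) :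
    (genCycle N d).Adj i (i + t) ↔ (genCycle N d).Adj 0 t := by
  have h : ∀ (a b : Fin N) (k : ℕ), ((a : ℕ) + k) % N = b ↔ a + Fin.ofNat N k = b := fun a b k => by
    rw [Fin.ext_iff, Fin.val_add, Fin.val_ofNat, Nat.add_mod_mod]
  simp only [genCycle, SimpleGraph.fromRel_adj, h, ne_eq, left_eq_add, zero_add, add_right_inj,
    eq_comm (a := (0 : Fin N)), add_assoc, add_eq_left]

open Classical in
lemma lapQuad_genCycle {N d : ℕ} [NeZero N] (x : Fin N → ℝ) :
    lapQuad (genCycle N d) x =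
      shiftEnergy (fun t => if (genCycle N d).Adj 0 t then 1 / 2 else 0) x := by
  rw [lapQuad_eq, shiftEnergy]
  simp only [Finset.mul_sum]
  rw [Finset.sum_comm (f := fun t i => _ * (x (i + t) - x i) ^ 2), Finset.sum_div]
  refine Finset.sum_congr rfl fun i _ => ?_
  rw [← Equiv.sum_comp (Equiv.addLeft i), Finset.sum_div]
  refine Finset.sum_congr rfl fun t _ => ?_
  simp only [Equiv.coe_addLeft, genCycle_adj_add]
  split_ifs <;> ring

lemma natCast_le_sum_alternating (d : ℕ) :
    (d : ℝ) ≤ ∑ r ∈ Finset.range d, (1 / 2) * ((-1 : ℝ) ^ (r + 1) - 1) ^ 2 := by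
  have h : ∑ r ∈ Finset.range d, (1 / 2) * ((-1 : ℝ) ^ (r + 1) - 1) ^ 2 =
      (d + (1 - (-1) ^ d) / 2 : ℝ) := by
    induction d with
    | zero => simp
    | succ d ih =>
      rw [Finset.sum_range_succ, ih]
      rcases neg_one_pow_eq_or ℝ d with h | h <;> simp only [pow_succ, h] <;> push_cast <;> ring
  rw [h]
  rcases neg_one_pow_eq_or ℝ d with h | h <;> rw [h] <;> norm_num

/-- Alternating functions have large energy on the generalized cycle. -/
lemma two_mul_le_lapQuad_alternating {n d : ℕ} [NeZero (2 * n)] (hn : d + 2 ≤ n)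
    {g : Fin (2 * n) → ℝ} (hg : ∀ c, g (c + 1) = -g c) :
    2 * d * ∑ i, g i ^ 2 ≤ lapQuad (genCycle (2 * n) d) g := by
  classical
  set F : ℕ → ℝ := fun r =>
    if 1 ≤ r ∧ (r ≤ d ∨ 2 * n ≤ r + d) then (1 / 2) * ((-1 : ℝ) ^ r - 1) ^ 2 else 0 with hF
  have hF0 : ∀ r, 0 ≤ F r := fun r => by
    simp only [hF]
    split_ifs <;> positivity
  have hsum : 2 * (d : ℝ) ≤ ∑ r ∈ Finset.range (2 * n), F r := by
    rw [two_mul n, Finset.sum_range_add, two_mul]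
    refine add_le_add ?_ ?_
    · calc (d : ℝ) ≤ ∑ r ∈ Finset.range d, F (r + 1) := by
            refine (natCast_le_sum_alternating d).trans_eq (Finset.sum_congr rfl fun r hr => ?_)
            rw [Finset.mem_range] at hr
            simp only [hF]
            rw [if_pos (by omega)]
        _ ≤ ∑ r ∈ Finset.range (d + 1), F r := by
            rw [Finset.sum_range_succ']
            linarith [hF0 0]
        _ ≤ _ := Finset.sum_le_sum_of_subset_of_nonneg
            (Finset.range_mono (by omega)) fun r _ _ => hF0 r
    · rw [← Finset.sum_range_reflect]
      calc (d : ℝ) ≤ ∑ r ∈ Finset.range d, F (n + (n - 1 - r)) := by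
            refine (natCast_le_sum_alternating d).trans_eq (Finset.sum_congr rfl fun r hr => ?_)
            rw [Finset.mem_range] at hr
            simp only [hF]
            rw [if_pos (by omega), neg_one_pow_congr (n := n + (n - 1 - r)) (m := r + 1)]
            rw [Nat.even_iff, Nat.even_iff]
            omega
        _ ≤ _ := Finset.sum_le_sum_of_subset_of_nonneg
            (Finset.range_mono (by omega)) fun r _ _ => hF0 _
  have hadj : ∀ t : Fin (2 * n), 1 ≤ (t : ℕ) ∧ ((t : ℕ) ≤ d ∨ 2 * n ≤ t + d) →
      (genCycle (2 * n) d).Adj 0 t := fun t ht => by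
    rw [genCycle, SimpleGraph.fromRel_adj]
    refine ⟨fun h => by rw [← h] at ht; simp at ht, ?_⟩
    rcases ht.2 with h | h
    · exact Or.inl ⟨t, ht.1, h, by simp [Nat.mod_eq_of_lt t.2]⟩
    · exact Or.inr ⟨2 * n - t, by omega, by omega, by
        rw [Nat.add_sub_cancel' t.2.le, Nat.mod_self]; rfl⟩
  rw [lapQuad_genCycle, shiftEnergy]
  calc _ ≤ (∑ r ∈ Finset.range (2 * n), F r) * ∑ i, g i ^ 2 :=
        mul_le_mul_of_nonneg_right hsum (Finset.sum_nonneg fun i _ => sq_nonneg _)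
    _ = ∑ t : Fin (2 * n), F t * ∑ i, g i ^ 2 := by
        rw [← Fin.sum_univ_eq_sum_range, Finset.sum_mul]
    _ ≤ _ := by
        refine Finset.sum_le_sum fun t _ => ?_
        have ht : ∑ i, (g (i + t) - g i) ^ 2 = ((-1) ^ (t : ℕ) - 1) ^ 2 * ∑ i, g i ^ 2 := by
          rw [Finset.mul_sum]
          refine Finset.sum_congr rfl fun i _ => ?_
          have h := alternating_add_nsmul hg t i
          rw [← fin_eq_nsmul_one] at h
          rw [h]
          ring
        have hnn : 0 ≤ ∑ i, (g (i + t) - g i) ^ 2 := Finset.sum_nonneg fun i _ => sq_nonneg _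
        by_cases h : 1 ≤ (t : ℕ) ∧ ((t : ℕ) ≤ d ∨ 2 * n ≤ t + d)
        · simp only [hF]
          rw [if_pos h, if_pos (hadj t h), ht, mul_assoc]
        · simp only [hF]
          rw [if_neg h, zero_mul]
          split_ifs <;> positivity

/-- For `d ≥ 2` and `n ≥ d + 2`, the algebraic connectivity of the
generalized path graph is at most that of the generalized cycle graph on `2n` vertices:
`a₁(P_{n,d}) ≤ a₁(C_{2n,d})`. -/
theorem algConn_genPath_le_genCycle (d n : ℕ) (hd : 2 ≤ d) (hn : d + 2 ≤ n) :
    algConn (genPath n d) ≤ algConn (genCycle (2 * n) d) := by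
  have : NeZero (2 * n) := ⟨by omega⟩
  have hgap : ∀ x : Fin (2 * n) → ℝ, ∑ i, x i = 0 →
      algConn (genPath n d) * ∑ i, x i ^ 2 ≤ lapQuad (genCycle (2 * n) d) x := fun x hx => by
    obtain ⟨z, g, rfl, hz, hg, hg'⟩ :=
      exists_double_decomposition (e := (1 : Fin (2 * n))) (fun t => ⟨t, fin_eq_nsmul_one t⟩) hx
    rw [sum_sq_add_of_double_periodic hz hg, lapQuad_genCycle,
      shiftEnergy_add_of_double_periodic hz hg, mul_add]
    refine add_le_add (gap_of_symmetric_gap (e := 1) (fun y hy hsum => ?_) hz) ?_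
    · rw [← lapQuad_genCycle]
      exact algConn_genPath_mul_le_of_symmetric hy hsum
    · rw [← lapQuad_genCycle]
      exact (mul_le_mul_of_nonneg_right (algConn_genPath_le (by omega))
        (Finset.sum_nonneg fun i _ => sq_nonneg _)).trans (two_mul_le_lapQuad_alternating hn hg')
  refine le_csInf ?_ ?_
  · refine ⟨_, fun i => (if i = 0 then (1 : ℝ) else 0) - if i = 1 then 1 else 0, ?_, ?_, rfl⟩
    · intro h
      have h01 : (0 : Fin (2 * n)) ≠ 1 := by
        rw [ne_eq, Fin.ext_iff, Fin.val_one', Nat.mod_eq_of_lt (by omega)]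
        simp
      simpa [h01] using congrFun h 0
    · simp
  · rintro r ⟨x, hx0, hx, rfl⟩
    have hpos : 0 < ∑ i, x i * x i := by
      obtain ⟨i, hi⟩ := Function.ne_iff.mp hx0
      exact Finset.sum_pos' (fun _ _ => mul_self_nonneg _)
        ⟨i, Finset.mem_univ _, mul_self_pos.mpr hi⟩
    rw [le_div_iff₀ hpos]
    simpa only [sq] using hgap x hx
end

section
/- Let d, n ∈ ℕ with d ≥ 1 and n ≥ d + 2, and let S_{n,d} be the generalized star graph. Then S_{n,d} is connected and its algebraic connectivity satisfies a₁(S_{n,d}) = d. -/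
/-- The generalized star graph `S_{n,d}` on vertex set `Fin n` (vertex `i` stands for the
label `i + 1 ∈ {1, …, n}`): distinct vertices are adjacent iff one of them is among the
first `d` vertices. -/
def genStar (n d : ℕ) : SimpleGraph (Fin n) :=
  SimpleGraph.fromRel (fun i _j => (i : ℕ) < d)
open Classical in
theorem lapQuad_eq_sum {m : ℕ} (G : SimpleGraph (Fin m)) (x : Fin m → ℝ) :
    lapQuad G x = (∑ i, ∑ j, if G.Adj i j then (x i - x j) ^ 2 else 0) / 2 := by
  rw [← SimpleGraph.lapMatrix_toLinearMap₂', Matrix.toLinearMap₂'_apply']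
  simp only [lapQuad, dotProduct, mul_comm]

theorem genStar_adj {n d : ℕ} (i j : Fin n) :
    (genStar n d).Adj i j ↔ i ≠ j ∧ ((i : ℕ) < d ∨ (j : ℕ) < d) := by
  simp [genStar, SimpleGraph.fromRel_adj]

theorem genStar_connected {n d : ℕ} (hd : 1 ≤ d) (hn : 1 ≤ n) : (genStar n d).Connected := by
  rw [SimpleGraph.connected_iff_exists_forall_reachable]
  refine ⟨⟨0, hn⟩, fun j => ?_⟩
  by_cases h : (⟨0, hn⟩ : Fin n) = j
  · rw [h]
  · exact ((genStar_adj _ _).2 ⟨h, Or.inl hd⟩).reachable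

/-- On vectors with zero sum the Laplacian form of `S_{n,d}` is `d‖x‖²` plus terms that only
involve the first `d` coordinates. -/
theorem lapQuad_genStar {n d : ℕ} (hdn : d ≤ n) (x : Fin n → ℝ) (hx : ∑ i, x i = 0) :
    lapQuad (genStar n d) x = d * (∑ i, x i * x i)
      + (n - d) * (∑ i : Fin n, if (i : ℕ) < d then x i * x i else 0)
      + (∑ i : Fin n, if (i : ℕ) < d then x i else 0) ^ 2 := by
  classical
  set c : Fin n → ℝ := fun i => if (i : ℕ) < d then 1 else 0 with hc
  have hcard : ∑ i, c i = d := by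
    simp only [hc, Finset.sum_boole]
    rw [Fin.card_filter_val_lt, min_eq_right hdn]
  have hterm (i j : Fin n) : (if (genStar n d).Adj i j then (x i - x j) ^ 2 else 0) =
      (c i * (x i * x i)) * 1 + c i * (x j * x j) + (x i * x i) * c j + 1 * (c j * (x j * x j))
        - 2 * ((c i * x i) * x j) - 2 * (x i * (c j * x j))
        - (c i * (x i * x i)) * c j - c i * (c j * (x j * x j))
        + 2 * ((c i * x i) * (c j * x j)) := by
    by_cases hij : i = j
    · subst hij
      simp only [SimpleGraph.irrefl, if_false]
      ring
    · simp only [genStar_adj, ne_eq, hij, not_false_eq_true, true_and, hc]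
      by_cases hi : (i : ℕ) < d <;> by_cases hj : (j : ℕ) < d <;> simp [hi, hj] <;> ring
  have hq : (∑ i : Fin n, if (i : ℕ) < d then x i * x i else 0) = ∑ i, c i * (x i * x i) := by
    simp [hc]
  have hs : (∑ i : Fin n, if (i : ℕ) < d then x i else 0) = ∑ i, c i * x i := by
    simp [hc]
  rw [lapQuad_eq_sum, hq, hs]
  simp only [hterm, Finset.sum_add_distrib, Finset.sum_sub_distrib, ← Finset.mul_sum,
    ← Finset.sum_mul, hcard, hx, Finset.sum_const, Finset.card_univ, Fintype.card_fin,
    nsmul_eq_mul]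
  ring

/-- For `d ≥ 1` and `n ≥ d + 2`, the generalized star graph `S_{n,d}` is
connected and its algebraic connectivity equals `d`. -/
theorem algConn_genStar (d n : ℕ) (hd : 1 ≤ d) (hn : d + 2 ≤ n) :
    (genStar n d).Connected ∧ algConn (genStar n d) = d := by
  refine ⟨genStar_connected hd (by omega), IsLeast.csInf_eq ⟨?_, ?_⟩⟩
  · let a : Fin n := ⟨d, by omega⟩
    let b : Fin n := ⟨d + 1, by omega⟩
    have hab : a ≠ b := by simp [a, b]
    let x : Fin n → ℝ := Pi.single a 1 - Pi.single b 1
    have hxa : x a = 1 := by simp [x, hab]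
    have hx0 : x ≠ 0 := fun h => by simp [h] at hxa
    have hsum : ∑ i, x i = 0 := by simp [x, Finset.sum_sub_distrib]
    have hlow (i : Fin n) (hi : (i : ℕ) < d) : x i = 0 := by
      have h1 : i ≠ a := fun h => by simp [h, a] at hi
      have h2 : i ≠ b := fun h => by simp [h, b] at hi
      simp [x, h1, h2]
    have hpos : ∑ i, x i * x i ≠ 0 := fun h => hx0 <| funext fun i => by
      simpa using (Finset.sum_eq_zero_iff_of_nonneg fun i _ => mul_self_nonneg (x i)).1 h i
    refine ⟨x, hx0, hsum, ?_⟩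
    have hq : (∑ i : Fin n, if (i : ℕ) < d then x i * x i else 0) = 0 :=
      Finset.sum_eq_zero fun i _ => by split_ifs with h <;> simp [hlow i, h]
    have hs : (∑ i : Fin n, if (i : ℕ) < d then x i else 0) = 0 :=
      Finset.sum_eq_zero fun i _ => by split_ifs with h <;> simp [hlow i, h]
    rw [lapQuad_genStar (by omega) x hsum, hq, hs, eq_div_iff hpos]
    ring
  · rintro r ⟨x, hx0, hsum, rfl⟩
    have hpos : 0 < ∑ i, x i * x i := by
      obtain ⟨i, hi⟩ := Function.ne_iff.1 hx0
      exact Finset.sum_pos' (fun i _ => mul_self_nonneg (x i))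
        ⟨i, Finset.mem_univ i, mul_self_pos.2 hi⟩
    rw [le_div_iff₀ hpos, lapQuad_genStar (by omega) x hsum, add_assoc]
    refine le_add_of_nonneg_right (add_nonneg (mul_nonneg ?_ ?_) (sq_nonneg _))
    · exact sub_nonneg.2 (by exact_mod_cast (by omega : d ≤ n))
    · exact Finset.sum_nonneg fun i _ => by split_ifs <;> simp [mul_self_nonneg]
end
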